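/- arXiv:math/0104192 — 3 statements merged into one kernel-verified Lean document; each statement's English description precedes it below -/
import Mathlib

section
/- Let Λ be a lattice in ℝ² with covolume A and minimal length R. Then there exists a ℤ-basis {x, y} of Λ such that ‖x‖ = R and ‖y‖ ≤ 2A/(√3·R). -/
open Module

/-- A vector with coprime coordinates in a rank-two basis is the first vector of a basis whose
second vector may be translated by any multiple of the first. -/
theorem Module.Basis.exists_basis_of_isCoprime_repr {S M : Type*} [CommRing S] [AddCommGroup M]
    [Module S M] (e : Basis (Fin 2) S M) (x : M) (hx : IsCoprime (e.repr x 0) (e.repr x 1)) :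
    ∃ y : M, ∀ k : S, ∃ b : Basis (Fin 2) S M, b 0 = x ∧ b 1 = y + k • x := by
  obtain ⟨u, v, huv⟩ := hx
  refine ⟨-v • e 0 + u • e 1, fun k => ?_⟩
  have hdet : IsUnit (e.det ![x, -v • e 0 + u • e 1 + k • x]) := by
    convert isUnit_one (M := S) using 1
    rw [Basis.det_apply, Matrix.det_fin_two]
    simp [Basis.toMatrix_apply]
    linear_combination huv
  obtain ⟨hli, hspan⟩ := e.is_basis_iff_det.2 hdet
  exact ⟨Basis.mk hli hspan.ge, by simp, by simp⟩

/-- A shortest nonzero vector of a rank-two subgroup of a normed space has coprime coordinates. -/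
theorem Module.Basis.isCoprime_repr_of_forall_norm_le {E : Type*} [NormedAddCommGroup E]
    [NormedSpace ℝ E] {L : Submodule ℤ E} (e : Basis (Fin 2) ℤ L) {x : L} (hx : x ≠ 0)
    (hmin : ∀ z : L, z ≠ 0 → ‖(x : E)‖ ≤ ‖(z : E)‖) :
    IsCoprime (e.repr x 0) (e.repr x 1) := by
  have hsum : e.repr x 0 • e 0 + e.repr x 1 • e 1 = x := by
    rw [← Fin.sum_univ_two fun i => e.repr x i • e i, e.sum_repr]
  have hgcd : 0 < Int.gcd (e.repr x 0) (e.repr x 1) := by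
    refine Nat.pos_of_ne_zero fun h => hx ?_
    obtain ⟨h0, h1⟩ := Int.gcd_eq_zero_iff.1 h
    rw [← hsum, h0, h1, zero_smul, zero_smul, add_zero]
  obtain ⟨m, n, -, hm, hn⟩ := Int.exists_gcd_one hgcd
  rw [Int.isCoprime_iff_gcd_eq_one]
  generalize Int.gcd (e.repr x 0) (e.repr x 1) = g at *
  set z : L := m • e 0 + n • e 1
  have hxz : x = g • z := by
    rw [← hsum, hm, hn, ← natCast_zsmul, smul_add, smul_smul, smul_smul, mul_comm m, mul_comm n]
  have hz : z ≠ 0 := by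
    intro h
    exact hx (by rw [hxz, h, smul_zero])
  have hle := hmin z hz
  have hzpos : 0 < ‖(z : E)‖ := norm_pos_iff.2 (by simpa using hz)
  rw [hxz, Submodule.coe_smul_of_tower, ← Nat.cast_smul_eq_nsmul ℝ, _root_.norm_smul,
    Real.norm_natCast] at hle
  have : (g : ℝ) ≤ 1 := by
    by_contra! h
    nlinarith
  have : g ≤ 1 := by exact_mod_cast this
  omega

/-- The covolume of a planar lattice is the absolute determinant of any of its bases. -/
theorem ZLattice.covolume_euclideanSpace_fin_two
    (L : Submodule ℤ (EuclideanSpace ℝ (Fin 2))) [DiscreteTopology L] [IsZLattice ℝ L]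
    (b : Basis (Fin 2) ℤ L) :
    ZLattice.covolume L =
      |(b 0 : EuclideanSpace ℝ (Fin 2)) 0 * (b 1 : EuclideanSpace ℝ (Fin 2)) 1 -
        (b 1 : EuclideanSpace ℝ (Fin 2)) 0 * (b 0 : EuclideanSpace ℝ (Fin 2)) 1| := by
  rw [ZLattice.covolume_eq_det_mul_measureReal L _ b (EuclideanSpace.basisFun (Fin 2) ℝ).toBasis,
    MeasureTheory.measureReal_congr (ZSpan.fundamentalDomain_ae_parallelepiped _ _),
    OrthonormalBasis.coe_toBasis, MeasureTheory.measureReal_def,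
    OrthonormalBasis.volume_parallelepiped, Basis.det_apply, Matrix.det_fin_two]
  simp [Basis.toMatrix_apply]

/-- Lagrange's identity in the plane. -/
theorem EuclideanSpace.norm_sq_mul_norm_sq_fin_two (x y : EuclideanSpace ℝ (Fin 2)) :
    ‖x‖ ^ 2 * ‖y‖ ^ 2 = inner ℝ x y ^ 2 + (x 0 * y 1 - y 0 * x 1) ^ 2 := by
  simp only [EuclideanSpace.real_norm_sq_eq, PiLp.inner_apply, Fin.sum_univ_two,
    RCLike.inner_apply, conj_trivial]
  ring

/-- Some integer translate of `y` along `x` is size-reduced with respect to `x`. -/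
theorem exists_int_two_mul_abs_inner_add_smul_le {E : Type*} [NormedAddCommGroup E]
    [InnerProductSpace ℝ E] (x y : E) :
    ∃ k : ℤ, 2 * |inner ℝ x (y + k • x)| ≤ ‖x‖ ^ 2 := by
  rcases eq_or_ne x 0 with rfl | hx
  · exact ⟨0, by simp⟩
  have hpos : 0 < ‖x‖ ^ 2 := by positivity
  refine ⟨-round (inner ℝ x y / ‖x‖ ^ 2), ?_⟩
  have h := abs_sub_round (inner ℝ x y / ‖x‖ ^ 2)
  generalize round (inner ℝ x y / ‖x‖ ^ 2) = k at *
  have heq : inner ℝ x (y + (-k) • x) = (inner ℝ x y / ‖x‖ ^ 2 - k) * ‖x‖ ^ 2 := by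
    rw [← Int.cast_smul_eq_zsmul ℝ, inner_add_right, inner_smul_right,
      real_inner_self_eq_norm_sq]
    push_cast
    field_simp
    ring
  rw [heq, abs_mul, abs_of_pos hpos]
  nlinarith

/-- A lattice in `ℝ²` with covolume `A` and minimal length `R` has a
`ℤ`-basis `{x, y}` with `‖x‖ = R` and `‖y‖ ≤ 2A/(√3·R)`. -/
theorem short_basis_exists
    (Λ : Submodule ℤ (EuclideanSpace ℝ (Fin 2))) [DiscreteTopology Λ] [IsZLattice ℝ Λ]
    (A R : ℝ) (hA : A = ZLattice.covolume Λ)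
    (hR : IsLeast {r : ℝ | ∃ v ∈ Λ, v ≠ 0 ∧ ‖v‖ = r} R) :
    ∃ b : Module.Basis (Fin 2) ℤ Λ,
      ‖(b 0 : EuclideanSpace ℝ (Fin 2))‖ = R ∧
      ‖(b 1 : EuclideanSpace ℝ (Fin 2))‖ ≤ 2 * A / (Real.sqrt 3 * R) := by
  obtain ⟨⟨x, hxΛ, hx, hxR⟩, hmin⟩ := hR
  have hRpos : 0 < R := hxR ▸ norm_pos_iff.2 hx
  have hmin' (z : Λ) (hz : z ≠ 0) : R ≤ ‖(z : EuclideanSpace ℝ (Fin 2))‖ :=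
    hmin ⟨z, z.2, by simpa using hz, rfl⟩
  have hrank : finrank ℤ Λ = 2 := by rw [ZLattice.rank ℝ Λ, finrank_euclideanSpace_fin]
  let e := finBasisOfFinrankEq ℤ Λ hrank
  have hcop := e.isCoprime_repr_of_forall_norm_le (x := ⟨x, hxΛ⟩) (by simpa using hx)
    (by simpa only [hxR] using hmin')
  obtain ⟨y, hy⟩ := e.exists_basis_of_isCoprime_repr _ hcop
  obtain ⟨k, hk⟩ := exists_int_two_mul_abs_inner_add_smul_le x (y : EuclideanSpace ℝ (Fin 2))
  obtain ⟨b, hb0, hb1⟩ := hy k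
  have hb0x : (b 0 : EuclideanSpace ℝ (Fin 2)) = x := by rw [hb0]
  refine ⟨b, by rw [hb0x, hxR], ?_⟩
  have hinner : 2 * |inner ℝ x (b 1 : EuclideanSpace ℝ (Fin 2))| ≤ R ^ 2 := by
    rw [← hxR, hb1]
    exact hk
  have hlag := EuclideanSpace.norm_sq_mul_norm_sq_fin_two x (b 1)
  have hcov := ZLattice.covolume_euclideanSpace_fin_two Λ b
  have hyR := hmin' (b 1) (b.ne_zero 1)
  rw [← hA, hb0x] at hcov
  have hA0 : 0 ≤ A := hcov ▸ abs_nonneg _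
  rw [← sq_abs (_ - _), ← hcov, hxR, ← sq_abs (inner ℝ _ _)] at hlag
  generalize ‖(b 1 : EuclideanSpace ℝ (Fin 2))‖ = s at *
  have hsq : (2 * |inner ℝ x (b 1 : EuclideanSpace ℝ (Fin 2))|) ^ 2 ≤ R ^ 2 * s ^ 2 := by
    calc _ ≤ (R ^ 2) ^ 2 := by gcongr
      _ = R ^ 2 * R ^ 2 := by ring
      _ ≤ R ^ 2 * s ^ 2 := by gcongr
  rw [le_div_iff₀ (by positivity)]
  refine le_of_sq_le_sq ?_ (by positivity)
  rw [mul_pow, mul_pow, Real.sq_sqrt (by norm_num)]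
  linarith
end

section
/- Let Λ be a lattice in ℝ² with minimal length R, and let {x, y} be a ℤ-basis of Λ with ‖x‖ = R and ‖y‖ ≤ 2A/(√3·R), where A is the covolume of Λ. Then every nonzero λ ∈ Λ, written λ = a·x + b·y with a, b ∈ ℤ, satisfies max(|a|, |b|) ≤ 2‖λ‖/(√3·R). -/
open MeasureTheory Module

namespace ZLattice

variable {E : Type*} [NormedAddCommGroup E] [InnerProductSpace ℝ E] [FiniteDimensional ℝ E]
  [MeasurableSpace E] [BorelSpace E] (L : Submodule ℤ E) [DiscreteTopology L] [IsZLattice ℝ L]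

/-- The covolume of a lattice is the absolute determinant of a `ℤ`-basis in orthonormal
coordinates. -/
theorem covolume_eq_abs_orthonormalBasis_det {ι : Type*} [Fintype ι] [DecidableEq ι]
    (b : Basis ι ℤ L) (e : OrthonormalBasis ι ℝ E) :
    covolume L = |e.toBasis.det ((↑) ∘ b)| := by
  rw [covolume_eq_det_mul_measureReal L volume b e.toBasis,
    measureReal_congr (ZSpan.fundamentalDomain_ae_parallelepiped e.toBasis volume),
    measureReal_def, e.coe_toBasis, e.volume_parallelepiped]
  simp

/-- The covolume of a planar lattice is the area spanned by a `ℤ`-basis. -/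
theorem covolume_eq_abs_areaForm [Fact (finrank ℝ E = 2)] (o : Orientation ℝ E (Fin 2))
    (b : Basis (Fin 2) ℤ L) :
    covolume L = |o.areaForm (b 0) (b 1)| := by
  let e := o.finOrthonormalBasis two_pos Fact.out
  rw [covolume_eq_abs_orthonormalBasis_det L b e, o.areaForm_to_volumeForm,
    o.volumeForm_robust e (o.finOrthonormalBasis_orientation _ _)]
  congr 2
  ext i
  fin_cases i <;> rfl

end ZLattice

/-- With respect to a short basis `{x, y}` of a lattice `Λ` in `ℝ²`
(`‖x‖ = R` the minimal length, `‖y‖ ≤ 2A/(√3 R)` with `A` the covolume), every nonzero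
lattice vector `λ = a·x + b·y` has `max(|a|,|b|) ≤ 2‖λ‖/(√3·R)`. -/
theorem short_basis_coefficient_bound
    (Λ : Submodule ℤ (EuclideanSpace ℝ (Fin 2))) [DiscreteTopology Λ] [IsZLattice ℝ Λ]
    (A R : ℝ) (hA : A = ZLattice.covolume Λ)
    (hR : IsLeast {r : ℝ | ∃ v ∈ Λ, v ≠ 0 ∧ ‖v‖ = r} R)
    (bas : Module.Basis (Fin 2) ℤ Λ)
    (hx : ‖(bas 0 : EuclideanSpace ℝ (Fin 2))‖ = R)
    (hy : ‖(bas 1 : EuclideanSpace ℝ (Fin 2))‖ ≤ 2 * A / (Real.sqrt 3 * R))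
    (l : EuclideanSpace ℝ (Fin 2)) (hlΛ : l ∈ Λ) (hl : l ≠ 0) (a b : ℤ)
    (hab : l = (a : ℤ) • (bas 0 : EuclideanSpace ℝ (Fin 2)) + (b : ℤ) • (bas 1 : EuclideanSpace ℝ (Fin 2))) :
    max (|a| : ℝ) (|b| : ℝ) ≤ 2 * ‖l‖ / (Real.sqrt 3 * R) := by
  have : Fact (finrank ℝ (EuclideanSpace ℝ (Fin 2)) = 2) := ⟨by simp⟩
  let o := (EuclideanSpace.basisFun (Fin 2) ℝ).toBasis.orientation
  set x := (bas 0 : EuclideanSpace ℝ (Fin 2))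
  set y := (bas 1 : EuclideanSpace ℝ (Fin 2)) with hy_def
  have hA_pos : 0 < A := hA ▸ ZLattice.covolume_pos Λ
  have hA_area : A = |o.areaForm x y| := hA.trans (ZLattice.covolume_eq_abs_areaForm Λ o bas)
  have hRy : R ≤ ‖y‖ := hR.2 ⟨y, (bas 1).2, by simpa [hy_def] using bas.ne_zero 1, rfl⟩
  have h_left : |(a : ℝ)| * A ≤ ‖l‖ * ‖y‖ := by
    have h_area : o.areaForm l y = a * o.areaForm x y := by simp [hab]
    rw [hA_area, ← abs_mul, ← h_area]
    exact o.abs_areaForm_le l y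
  have h_right : |(b : ℝ)| * A ≤ ‖l‖ * R := by
    have h_area : o.areaForm x l = b * o.areaForm x y := by simp [hab]
    rw [hA_area, ← abs_mul, ← h_area, mul_comm, ← hx]
    exact o.abs_areaForm_le x l
  have h_bound (c : ℝ) (hc : c * A ≤ ‖l‖ * ‖y‖) : c ≤ 2 * ‖l‖ / (Real.sqrt 3 * R) := by
    refine le_of_mul_le_mul_right ?_ hA_pos
    calc c * A ≤ ‖l‖ * ‖y‖ := hc
      _ ≤ ‖l‖ * (2 * A / (Real.sqrt 3 * R)) := by gcongr
      _ = 2 * ‖l‖ / (Real.sqrt 3 * R) * A := by ring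
  exact max_le (h_bound _ h_left) (h_bound _ (h_right.trans (by gcongr)))
end

section
/- Let n ≥ 2, let M > 0, and let A be a 2 × n integer matrix all of whose entries satisfy |a_{ij}| ≤ M, such that the induced linear map ℤⁿ → ℤ² is surjective. Then the kernel of this map is a free abelian group of rank n − 2 admitting a ℤ-basis s₁, …, s_{n−2} ∈ ℤⁿ all of whose coordinates c satisfy |c| ≤ 2M². -/
/-- The kernel of `f` on `W` has a basis of `d` vectors of `p`-size at most `r`, and every value
of `f` on `W` is attained at a vector of `W` of `p`-size at most `r - 1`. -/
def HasShortKernelBasis {V G : Type*} [AddCommGroup V] [AddCommGroup G] (f : V →ₗ[ℤ] G)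
    (p : AddGroupSeminorm V) (W : Submodule ℤ V) (d r : ℕ) : Prop :=
  (∃ b : Module.Basis (Fin d) ℤ (LinearMap.ker f ⊓ W : Submodule ℤ V), ∀ i, p (b i : V) ≤ r) ∧
    ∀ w ∈ W, ∃ w' ∈ W, f w' = f w ∧ p w' + 1 ≤ r

theorem AddSubgroup.relIndex_sup_zmultiples {G : Type*} [AddCommGroup G] (L : AddSubgroup G)
    (g : G) : L.relIndex (L ⊔ zmultiples g) = addOrderOf (g : G ⧸ L) := by
  have h := AddSubgroup.relIndex_ker (K := zmultiples g) (QuotientAddGroup.mk' L)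
  rw [QuotientAddGroup.ker_mk', AddMonoidHom.map_zmultiples, Nat.card_zmultiples] at h
  rw [relIndex_sup_left, h]
  rfl

theorem AddGroupSeminorm.map_zsmul_le {V : Type*} [AddCommGroup V] (p : AddGroupSeminorm V)
    (c : ℤ) (e : V) : p (c • e) ≤ |(c : ℝ)| * p e := by
  have key : ∀ m : ℕ, p (m • e) ≤ m * p e := by
    intro m
    induction m with
    | zero => simp
    | succ m ih =>
      rw [succ_nsmul]
      push_cast
      linarith [map_add_le_add p (m • e) e]
  obtain ⟨m, rfl | rfl⟩ := c.eq_nat_or_neg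
  · simpa using key m
  · simpa using key m

theorem HasShortKernelBasis.sup_span_singleton {V G : Type*} [AddCommGroup V] [AddCommGroup G]
    {f : V →ₗ[ℤ] G} {p : AddGroupSeminorm V} {W : Submodule ℤ V} {d r : ℕ}
    (h : HasShortKernelBasis f p W d r) {e : V} (he : p e ≤ 1)
    (hfree : ∀ c : ℤ, c • e ∈ W → c = 0)
    (hq : (W.map f).toAddSubgroup.relIndex ((W ⊔ ℤ ∙ e).map f).toAddSubgroup ≠ 0) :
    HasShortKernelBasis f p (W ⊔ ℤ ∙ e) (d + 1)
      (r * (W.map f).toAddSubgroup.relIndex ((W ⊔ ℤ ∙ e).map f).toAddSubgroup) := by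
  set L := (W.map f).toAddSubgroup with hL
  have hsup : ((W ⊔ ℤ ∙ e).map f).toAddSubgroup = L ⊔ AddSubgroup.zmultiples (f e) := by
    rw [Submodule.map_sup, Submodule.map_span, Set.image_singleton, Submodule.sup_toAddSubgroup,
      Submodule.span_singleton_toAddSubgroup_eq_zmultiples]
  rw [hsup, AddSubgroup.relIndex_sup_zmultiples] at hq ⊢
  set q := addOrderOf (f e : G ⧸ L) with hqdef
  have hmem : ∀ t : ℤ, (∃ w ∈ W, f w = t • f e) ↔ (q : ℤ) ∣ t := by
    intro t
    rw [hqdef, addOrderOf_dvd_iff_zsmul_eq_zero, ← QuotientAddGroup.mk_zsmul,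
      QuotientAddGroup.eq_zero_iff, hL, Submodule.mem_toAddSubgroup, Submodule.mem_map]
  obtain ⟨⟨b, hb⟩, hrep⟩ := h
  have hr1 : (1 : ℝ) ≤ r := by
    obtain ⟨w', -, -, hw'⟩ := hrep 0 W.zero_mem
    linarith [apply_nonneg p w']
  have hq1 : (1 : ℝ) ≤ q := by exact_mod_cast Nat.one_le_iff_ne_zero.mpr hq
  have hqr : (r : ℝ) + q ≤ r * q + 1 := by nlinarith
  have heW : e ∈ W ⊔ ℤ ∙ e := Submodule.mem_sup_right (Submodule.mem_span_singleton_self e)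
  have hWle : W ≤ W ⊔ ℤ ∙ e := le_sup_left
  constructor
  · obtain ⟨w₀, hw₀, hfw₀⟩ := (hmem q).mpr dvd_rfl
    obtain ⟨w, hw, hfw, hpw⟩ := hrep w₀ hw₀
    have hfw' : f w = (q : ℤ) • f e := hfw.trans hfw₀
    have hy : (q : ℤ) • e - w ∈ LinearMap.ker f ⊓ (W ⊔ ℤ ∙ e) := by
      refine ⟨?_, Submodule.sub_mem _ (Submodule.smul_mem _ _ heW) (hWle hw)⟩
      rw [SetLike.mem_coe, LinearMap.mem_ker, map_sub, map_smul, hfw', sub_self]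
    have hpy : p ((q : ℤ) • e - w) ≤ r * q := by
      have h1 := map_sub_le_add p ((q : ℤ) • e) w
      have h2 := p.map_zsmul_le q e
      have h3 : |((q : ℤ) : ℝ)| * p e ≤ q := by
        rw [Int.cast_natCast, Nat.abs_cast]
        nlinarith
      linarith
    have hli : ∀ c : ℤ, ∀ x ∈ LinearMap.ker f ⊓ W, c • ((q : ℤ) • e - w) + x = 0 → c = 0 := by
      intro c x hx hc
      have : (c * q) • e ∈ W := by
        have heq : (c * q) • e = c • w - x := by
          rw [mul_smul, ← sub_eq_zero, ← hc, smul_sub]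
          abel
        rw [heq]
        exact W.sub_mem (W.smul_mem _ hw) hx.2
      rcases mul_eq_zero.mp (hfree _ this) with h0 | h0
      · exact h0
      · exact absurd (by exact_mod_cast h0) hq
    have hsp : ∀ z ∈ LinearMap.ker f ⊓ (W ⊔ ℤ ∙ e),
        ∃ c : ℤ, z + c • ((q : ℤ) • e - w) ∈ LinearMap.ker f ⊓ W := by
      rintro z ⟨hz, hzW⟩
      obtain ⟨u, hu, v, hv, rfl⟩ := Submodule.mem_sup.mp hzW
      obtain ⟨t, rfl⟩ := Submodule.mem_span_singleton.mp hv
      have hz' : f u + t • f e = 0 := by simpa using hz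
      obtain ⟨s, rfl⟩ := (hmem t).mp ⟨-u, W.neg_mem hu, by
        rw [map_neg]; exact neg_eq_of_add_eq_zero_right hz'⟩
      refine ⟨-s, ?_, ?_⟩
      · exact Submodule.add_mem _ hz (Submodule.smul_mem _ _ hy.1)
      · have heq : u + ((q : ℤ) * s) • e + -s • ((q : ℤ) • e - w) = u + s • w := by
          rw [mul_comm, mul_smul, smul_sub, neg_smul, neg_smul]
          abel
        rw [heq]
        exact W.add_mem hu (W.smul_mem _ hw)
    refine ⟨Module.Basis.mkFinConsOfLE _ hy b (inf_le_inf_left _ hWle) hli hsp, fun i => ?_⟩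
    rw [Module.Basis.coe_mkFinConsOfLE]
    push_cast
    refine Fin.cases ?_ (fun i => ?_) i
    · exact hpy
    · have := hb i
      simp only [Fin.cons_succ, Function.comp_apply, Submodule.coe_inclusion]
      nlinarith
  · intro z hz
    obtain ⟨u, hu, v, hv, rfl⟩ := Submodule.mem_sup.mp hz
    obtain ⟨t, rfl⟩ := Submodule.mem_span_singleton.mp hv
    have hq0 : (q : ℤ) ≠ 0 := by exact_mod_cast hq
    obtain ⟨w₀, hw₀, hfw₀⟩ := (hmem (q * (t / q))).mpr (dvd_mul_right _ _)
    obtain ⟨w, hw, hfw, hpw⟩ := hrep (u + w₀) (W.add_mem hu hw₀)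
    refine ⟨w + (t % q) • e,
      Submodule.add_mem _ (hWle hw) (Submodule.smul_mem _ _ heW), ?_, ?_⟩
    · rw [map_add, map_smul, hfw, map_add, hfw₀, map_add, map_smul, add_assoc, ← add_smul,
        Int.mul_ediv_add_emod]
    · have h1 := map_add_le_add p w ((t % q) • e)
      have h2 := p.map_zsmul_le (t % q) e
      have h3 : |((t % q : ℤ) : ℝ)| + 1 ≤ q := by
        rw [← Int.cast_abs, abs_of_nonneg (Int.emod_nonneg _ hq0)]
        exact_mod_cast Int.emod_lt_of_pos t (by positivity)
      have h4 : |((t % q : ℤ) : ℝ)| * p e ≤ |((t % q : ℤ) : ℝ)| :=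
        mul_le_of_le_one_right (abs_nonneg _) he
      push_cast
      linarith

/-- The `ℓ¹` size of the part of an integer vector outside `T`. -/
def l1SeminormOutside {ι : Type*} [Fintype ι] [DecidableEq ι] (T : Finset ι) :
    AddGroupSeminorm (ι → ℤ) where
  toFun x := ∑ j ∈ Tᶜ, |(x j : ℝ)|
  map_zero' := by simp
  add_le' x y := by
    rw [← Finset.sum_add_distrib]
    refine Finset.sum_le_sum fun j _ => ?_
    push_cast [Pi.add_apply]
    exact abs_add_le _ _
  neg' x := by simp

theorem l1SeminormOutside_apply {ι : Type*} [Fintype ι] [DecidableEq ι] (T : Finset ι)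
    (x : ι → ℤ) : l1SeminormOutside T x = ∑ j ∈ Tᶜ, |(x j : ℝ)| := rfl

/-- The integer vectors supported on `s`. -/
def vectorsSupportedOn {ι : Type*} (s : Finset ι) : Submodule ℤ (ι → ℤ) where
  carrier := {x | ∀ j ∉ s, x j = 0}
  add_mem' hx hy j hj := by simp [hx j hj, hy j hj]
  zero_mem' := by simp
  smul_mem' c x hx j hj := by simp [hx j hj]

theorem vectorsSupportedOn_insert {ι : Type*} [DecidableEq ι] (k : ι) (s : Finset ι) :
    vectorsSupportedOn (insert k s) = vectorsSupportedOn s ⊔ ℤ ∙ (Pi.single k 1 : ι → ℤ) := by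
  apply le_antisymm
  · intro x hx
    refine Submodule.mem_sup.mpr ⟨x - x k • Pi.single k 1, fun j hj => ?_, _,
      Submodule.smul_mem _ (x k) (Submodule.mem_span_singleton_self _), sub_add_cancel _ _⟩
    by_cases hjk : j = k
    · subst hjk; simp
    · simp [hx j (by simp [hjk, hj]), hjk]
  · refine sup_le (fun x hx j hj => hx j fun h => hj (Finset.mem_insert_of_mem h)) ?_
    rw [Submodule.span_singleton_le_iff_mem]
    intro j hj
    have hjk : j ≠ k := fun h => hj (h ▸ Finset.mem_insert_self _ _)
    simp [hjk]

theorem hasShortKernelBasis_vectorsSupportedOn {ι G : Type*} [Fintype ι] [DecidableEq ι]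
    [AddCommGroup G] (f : (ι → ℤ) →ₗ[ℤ] G) (T : Finset ι)
    (hinj : LinearMap.ker f ⊓ vectorsSupportedOn T = ⊥)
    (hindex : ((vectorsSupportedOn T).map f).toAddSubgroup.index ≠ 0)
    (s : Finset ι) (hs : Disjoint s T) :
    HasShortKernelBasis f (l1SeminormOutside T) (vectorsSupportedOn (s ∪ T)) s.card
      (((vectorsSupportedOn T).map f).toAddSubgroup.relIndex
        ((vectorsSupportedOn (s ∪ T)).map f).toAddSubgroup) := by
  induction s using Finset.induction_on with
  | empty =>
    rw [Finset.empty_union, AddSubgroup.relIndex_self, Finset.card_empty]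
    have : Subsingleton (LinearMap.ker f ⊓ vectorsSupportedOn T : Submodule ℤ (ι → ℤ)) := by
      rw [hinj]; infer_instance
    refine ⟨⟨Module.Basis.empty _, fun i => i.elim0⟩, fun w hw => ⟨w, hw, rfl, ?_⟩⟩
    have : l1SeminormOutside T w = 0 := by
      rw [l1SeminormOutside_apply]
      exact Finset.sum_eq_zero fun j hj => by simp [hw j (Finset.mem_compl.mp hj)]
    simp [this]
  | insert k s hk ih =>
    rw [Finset.disjoint_insert_left] at hs
    have hkn : k ∉ s ∪ T := by simp [hk, hs.1]
    have hmono : vectorsSupportedOn T ≤ vectorsSupportedOn (s ∪ T) :=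
      fun x hx j hj => hx j fun h => hj (Finset.mem_union_right _ h)
    have hLle : ((vectorsSupportedOn T).map f).toAddSubgroup ≤
        ((vectorsSupportedOn (s ∪ T)).map f).toAddSubgroup :=
      Submodule.toAddSubgroup_mono (Submodule.map_mono hmono)
    have hLle' : ((vectorsSupportedOn (s ∪ T)).map f).toAddSubgroup ≤
        ((vectorsSupportedOn (s ∪ T) ⊔ ℤ ∙ (Pi.single k 1 : ι → ℤ)).map f).toAddSubgroup :=
      Submodule.toAddSubgroup_mono (Submodule.map_mono le_sup_left)
    rw [Finset.insert_union, vectorsSupportedOn_insert, Finset.card_insert_of_notMem hk,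
      ← AddSubgroup.relIndex_mul_relIndex _ _ _ hLle hLle']
    refine (ih hs.2).sup_span_singleton ?_ ?_ ?_
    · rw [l1SeminormOutside_apply, Finset.sum_eq_single k]
      · simp
      · intro j _ hj; simp [hj]
      · simp [hs.1]
    · intro c hc
      simpa using hc k hkn
    · intro h0
      have h1 := AddSubgroup.relIndex_dvd_index_of_le hLle'
      rw [h0, zero_dvd_iff] at h1
      have h2 := AddSubgroup.relIndex_mul_index hLle
      rw [h1, mul_zero] at h2
      exact hindex h2.symm

/-- The minor of `A` on the columns `i` and `j`. -/
def columnMinor {n : ℕ} (A : Matrix (Fin 2) (Fin n) ℤ) (i j : Fin n) : ℤ :=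
  A 0 i * A 1 j - A 0 j * A 1 i

theorem columnMinor_swap {n : ℕ} (A : Matrix (Fin 2) (Fin n) ℤ) (i j : Fin n) :
    columnMinor A j i = -columnMinor A i j := by
  unfold columnMinor; ring

theorem abs_columnMinor_le {n : ℕ} {A : Matrix (Fin 2) (Fin n) ℤ} {M : ℝ}
    (hbd : ∀ i j, (|A i j| : ℝ) ≤ M) (i j : Fin n) :
    |(columnMinor A i j : ℝ)| ≤ 2 * M ^ 2 := by
  have hmul : ∀ k l, |(A 0 k : ℝ) * A 1 l| ≤ M ^ 2 := fun k l => by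
    rw [abs_mul, sq]
    exact mul_le_mul (hbd 0 k) (hbd 1 l) (abs_nonneg _) ((abs_nonneg _).trans (hbd 0 k))
  rw [columnMinor]
  push_cast
  linarith [abs_sub (A 0 i * A 1 j : ℝ) (A 0 j * A 1 i), hmul i j, hmul j i]

theorem exists_columnMinor_ne_zero {n : ℕ} {A : Matrix (Fin 2) (Fin n) ℤ}
    (hsurj : Function.Surjective A.mulVecLin) : ∃ i j, columnMinor A i j ≠ 0 := by
  by_contra! h
  obtain ⟨x, hx⟩ := hsurj ![1, 0]
  obtain ⟨y, hy⟩ := hsurj ![0, 1]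
  have hx' : ∀ i, ∑ j, A i j * x j = ![1, 0] i := fun i => congrFun hx i
  have hy' : ∀ i, ∑ j, A i j * y j = ![0, 1] i := fun i => congrFun hy i
  have key : (∑ j, A 0 j * x j) * (∑ j, A 1 j * y j) -
      (∑ j, A 0 j * y j) * (∑ j, A 1 j * x j) =
      ∑ i, ∑ j, x i * y j * columnMinor A i j := by
    rw [Finset.sum_mul_sum, mul_comm (∑ j, A 0 j * y j), Finset.sum_mul_sum,
      ← Finset.sum_sub_distrib]
    refine Finset.sum_congr rfl fun i _ => ?_
    rw [← Finset.sum_sub_distrib]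
    refine Finset.sum_congr rfl fun j _ => ?_
    unfold columnMinor; ring
  simp [h, hx', hy'] at key

theorem sum_mul_columnMinor_eq_zero {n : ℕ} {A : Matrix (Fin 2) (Fin n) ℤ} {x : Fin n → ℤ}
    (hx : x ∈ LinearMap.ker A.mulVecLin) (k : Fin n) : ∑ j, x j * columnMinor A j k = 0 := by
  have hx' : ∀ i, ∑ j, A i j * x j = 0 := fun i => congrFun (LinearMap.mem_ker.mp hx) i
  have : ∑ j, x j * columnMinor A j k =
      (∑ j, A 0 j * x j) * A 1 k - (∑ j, A 1 j * x j) * A 0 k := by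
    rw [Finset.sum_mul, Finset.sum_mul, ← Finset.sum_sub_distrib]
    refine Finset.sum_congr rfl fun j _ => ?_
    unfold columnMinor; ring
  rw [this, hx', hx']; ring

theorem mul_columnMinor_eq_neg_sum {n : ℕ} {A : Matrix (Fin 2) (Fin n) ℤ} {x : Fin n → ℤ}
    (hx : x ∈ LinearMap.ker A.mulVecLin) {k l : Fin n} (hkl : k ≠ l) :
    x k * columnMinor A k l = -∑ j ∈ ({k, l} : Finset (Fin n))ᶜ, x j * columnMinor A j l := by
  have h := sum_mul_columnMinor_eq_zero hx l
  rw [← Finset.sum_add_sum_compl {k, l}, Finset.sum_pair hkl] at h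
  have : columnMinor A l l = 0 := by unfold columnMinor; ring
  rw [this] at h
  linarith

theorem abs_coord_mul_columnMinor_le {n : ℕ} {A : Matrix (Fin 2) (Fin n) ℤ} {M : ℝ}
    (hbd : ∀ i j, (|A i j| : ℝ) ≤ M) {x : Fin n → ℤ} (hx : x ∈ LinearMap.ker A.mulVecLin)
    {k l : Fin n} (hkl : k ≠ l) :
    |(x k : ℝ)| * |(columnMinor A k l : ℝ)| ≤ l1SeminormOutside {k, l} x * (2 * M ^ 2) := by
  have h : (x k : ℝ) * columnMinor A k l =
      -∑ j ∈ ({k, l} : Finset (Fin n))ᶜ, (x j : ℝ) * columnMinor A j l := by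
    exact_mod_cast mul_columnMinor_eq_neg_sum hx hkl
  rw [← abs_mul, h, abs_neg, l1SeminormOutside_apply, Finset.sum_mul]
  refine (Finset.abs_sum_le_sum_abs _ _).trans (Finset.sum_le_sum fun j _ => ?_)
  rw [abs_mul]
  exact mul_le_mul_of_nonneg_left (abs_columnMinor_le hbd j l) (abs_nonneg _)

theorem ker_inf_vectorsSupportedOn_pair {n : ℕ} {A : Matrix (Fin 2) (Fin n) ℤ} {k l : Fin n}
    (hkl : k ≠ l) (hD : columnMinor A k l ≠ 0) :
    LinearMap.ker A.mulVecLin ⊓ vectorsSupportedOn {k, l} = ⊥ := by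
  rw [eq_bot_iff]
  rintro x ⟨hx, hxs⟩
  have hzero : ∀ a b : Fin n, a ≠ b → columnMinor A a b ≠ 0 →
      ({a, b} : Finset (Fin n)) = {k, l} → x a = 0 := by
    intro a b hab hne hset
    have h := mul_columnMinor_eq_neg_sum hx hab
    rw [hset, Finset.sum_eq_zero fun j hj => by rw [hxs j (Finset.mem_compl.mp hj), zero_mul],
      neg_zero] at h
    exact (mul_eq_zero.mp h).resolve_right hne
  have hk := hzero k l hkl hD rfl
  have hl := hzero l k hkl.symm (by rwa [columnMinor_swap, neg_ne_zero]) (Finset.pair_comm _ _)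
  rw [Submodule.mem_bot]
  ext j
  by_cases hj : j ∈ ({k, l} : Finset (Fin n))
  · rcases Finset.mem_insert.mp hj with rfl | hj
    · exact hk
    · rw [Finset.mem_singleton.mp hj]; exact hl
  · exact hxs j hj

theorem index_map_vectorsSupportedOn_pair {n : ℕ} {A : Matrix (Fin 2) (Fin n) ℤ} {k l : Fin n}
    (hD : columnMinor A k l ≠ 0) :
    ((vectorsSupportedOn {k, l}).map A.mulVecLin).toAddSubgroup.index =
      (columnMinor A k l).natAbs := by
  set N := (vectorsSupportedOn {k, l}).map A.mulVecLin with hN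
  let v : Fin 2 → Fin 2 → ℤ := ![A.col k, A.col l]
  have hdet : (Matrix.of v).det = columnMinor A k l := by
    rw [Matrix.det_fin_two]
    simp [v, columnMinor]
    ring
  have hli : LinearIndependent ℤ v :=
    Matrix.linearIndependent_rows_of_det_ne_zero (A := Matrix.of v) (by rwa [hdet])
  have hspan : Submodule.span ℤ (Set.range v) = N := by
    have : vectorsSupportedOn ({k, l} : Finset (Fin n)) =
        Submodule.span ℤ {Pi.single k 1, Pi.single l 1} := by
      have h0 : vectorsSupportedOn (∅ : Finset (Fin n)) = ⊥ := by
        rw [eq_bot_iff]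
        intro x hx
        exact funext fun j => hx j (Finset.notMem_empty j)
      rw [← insert_empty_eq l, vectorsSupportedOn_insert, vectorsSupportedOn_insert, h0,
        bot_sup_eq, Submodule.span_insert, sup_comm]
    rw [hN, this, Submodule.map_span, Set.image_pair, Matrix.range_cons, Matrix.range_cons,
      Matrix.range_empty, Set.union_empty, Set.singleton_union]
    simp
  let bN : Module.Basis (Fin 2) ℤ N :=
    (Module.Basis.span hli).map (LinearEquiv.ofEq _ _ hspan)
  have hbN : ∀ i, (bN i : Fin 2 → ℤ) = v i := fun i => by
    simp [bN, Module.Basis.span_apply]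
  rw [AddSubgroup.index_eq_natAbs_det (Pi.basisFun ℤ (Fin 2)) N.toAddSubgroup bN, ← hdet,
    Pi.basisFun_det_apply]
  exact congrArg (fun u => (Matrix.of u).det.natAbs) (funext hbN)

/-- If `A` is a `2 × n` integer matrix (`n ≥ 2`) with entries bounded by
`M > 0` inducing a surjective map `ℤⁿ → ℤ²`, then its kernel is free abelian of rank
`n − 2` and admits a `ℤ`-basis all of whose coordinates are bounded by `2M²`. -/
theorem kernel_basis_bound
    (n : ℕ) (hn : 2 ≤ n) (M : ℝ) (hM : 0 < M)
    (A : Matrix (Fin 2) (Fin n) ℤ)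
    (hbd : ∀ i j, (|A i j| : ℝ) ≤ M)
    (hsurj : Function.Surjective A.mulVecLin) :
    ∃ b : Module.Basis (Fin (n - 2)) ℤ (LinearMap.ker A.mulVecLin),
      ∀ i j, (|(b i : Fin n → ℤ) j| : ℝ) ≤ 2 * M ^ 2 := by
  obtain ⟨k, l, hD⟩ := exists_columnMinor_ne_zero hsurj
  have hkl : k ≠ l := by
    rintro rfl
    exact hD (by unfold columnMinor; ring)
  have hindex := index_map_vectorsSupportedOn_pair hD
  have hindex0 : ((vectorsSupportedOn {k, l}).map A.mulVecLin).toAddSubgroup.index ≠ 0 := by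
    rw [hindex]; exact Int.natAbs_ne_zero.mpr hD
  obtain ⟨⟨b, hb⟩, -⟩ := hasShortKernelBasis_vectorsSupportedOn A.mulVecLin {k, l}
    (ker_inf_vectorsSupportedOn_pair hkl hD) hindex0 ({k, l}ᶜ) disjoint_compl_left
  have htop : LinearMap.ker A.mulVecLin ⊓ vectorsSupportedOn ({k, l}ᶜ ∪ {k, l}) =
      LinearMap.ker A.mulVecLin := by
    refine inf_eq_left.mpr fun x _ j hj => absurd ?_ hj
    rw [Finset.union_comm, Finset.union_compl]
    exact Finset.mem_univ j
  have hcard : (({k, l} : Finset (Fin n))ᶜ).card = n - 2 := by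
    rw [Finset.card_compl, Finset.card_pair hkl, Fintype.card_fin]
  set r := ((vectorsSupportedOn {k, l}).map A.mulVecLin).toAddSubgroup.relIndex
    ((vectorsSupportedOn ({k, l}ᶜ ∪ {k, l})).map A.mulVecLin).toAddSubgroup
  have hr : (r : ℝ) ≤ |(columnMinor A k l : ℝ)| := by
    have h1 : r ≤ (columnMinor A k l).natAbs := by
      rw [← hindex]
      exact Nat.le_of_dvd (Nat.pos_of_ne_zero hindex0)
        (AddSubgroup.relIndex_dvd_index_of_normal _ _)
    rw [← Int.cast_abs, Int.abs_eq_natAbs, Int.cast_natCast]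
    exact_mod_cast h1
  have hDpos : 0 < |(columnMinor A k l : ℝ)| := abs_pos.mpr (by exact_mod_cast hD)
  refine ⟨(b.map (LinearEquiv.ofEq _ _ htop)).reindex (finCongr hcard), fun i j => ?_⟩
  rw [Module.Basis.reindex_apply, Module.Basis.map_apply, LinearEquiv.coe_ofEq_apply]
  set x := b ((finCongr hcard).symm i)
  have hx : (x : Fin n → ℤ) ∈ LinearMap.ker A.mulVecLin := x.2.1
  have hp : l1SeminormOutside {k, l} (x : Fin n → ℤ) ≤ |(columnMinor A k l : ℝ)| :=
    (hb _).trans hr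
  have hbound : 0 ≤ 2 * M ^ 2 := by positivity
  by_cases hj : j ∈ ({k, l} : Finset (Fin n))
  · rcases Finset.mem_insert.mp hj with rfl | hj
    · have h := abs_coord_mul_columnMinor_le hbd hx hkl
      exact le_of_mul_le_mul_right
        ((h.trans (mul_le_mul_of_nonneg_right hp hbound)).trans_eq (mul_comm _ _)) hDpos
    · obtain rfl := Finset.mem_singleton.mp hj
      have hpair : l1SeminormOutside {j, k} (x : Fin n → ℤ) = l1SeminormOutside {k, j} x.1 :=
        congrArg (l1SeminormOutside · x.1) (Finset.pair_comm _ _)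
      have h := abs_coord_mul_columnMinor_le hbd hx hkl.symm
      rw [columnMinor_swap, Int.cast_neg, abs_neg, hpair] at h
      exact le_of_mul_le_mul_right
        ((h.trans (mul_le_mul_of_nonneg_right hp hbound)).trans_eq (mul_comm _ _)) hDpos
  · refine le_trans ?_ (hp.trans (abs_columnMinor_le hbd k l))
    rw [l1SeminormOutside_apply]
    exact Finset.single_le_sum (f := fun j => |((x : Fin n → ℤ) j : ℝ)|)
      (fun _ _ => abs_nonneg _) (Finset.mem_compl.mpr hj)
end
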